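/- arXiv:1212.1293 — 2 statements merged into one kernel-verified Lean document; each statement's English description precedes it below -/
import Mathlib

section
/- Let n ≥ 1 and Ω > 0, and for each ω ≥ Ω let x_1(ω),…,x_{2n}(ω) ∈ ℂ be pairwise distinct nodes such that: there is a constant B with ω·|x_j(ω)+1| ≤ B for j = 1,…,n and ω·|x_j(ω)−1| ≤ B for j = n+1,…,2n, and there is a constant c > 0 with |x_i(ω) − x_j(ω)| ≥ c/ω for all i ≠ j and all ω ≥ Ω. For each j let l_j(ω; ·) ∈ ℂ[X] be the Lagrange basis polynomial of degree 2n−1 for the nodes x_1(ω),…,x_{2n}(ω) (so l_j(ω; x_i(ω)) = 1 if i = j and 0 otherwise), and set w_j(ω) = ∫_{−1}^{1} l_j(ω; x)·e^{iωx} dx. Then there exists C such that |w_j(ω)| ≤ C·ω^{−1} for all j = 1,…,2n and all ω ≥ Ω; that is, the interpolatory quadrature weights satisfy w_j(ω) = O(ω^{−1}) as ω → ∞. -/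
open MeasureTheory

/-- Iterated derivative of a product with a polynomial of degree at most one. -/
lemma aux_iter_deriv_mul (f g : Polynomial ℂ) (a : ℂ) (hf : Polynomial.derivative f = Polynomial.C a)
    (k : ℕ) :
    Polynomial.derivative^[k] (f * g) = f * Polynomial.derivative^[k] g +
      (k : Polynomial ℂ) * Polynomial.C a * Polynomial.derivative^[k-1] g := by
  induction k with
  | zero => simp
  | succ k ih =>
    rw [Function.iterate_succ_apply', ih]
    rcases k with _ | k
    · simp [hf]; ring
    · simp only [Nat.add_sub_cancel, Polynomial.derivative_add, Polynomial.derivative_mul, hf,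
        Polynomial.derivative_natCast, Polynomial.derivative_C,
        ← Function.iterate_succ_apply' (f := (Polynomial.derivative : Polynomial ℂ → Polynomial ℂ))]
      push_cast
      ring

/-- Derivative bounds for a product of linear factors. -/
lemma aux_prod_bound {ι : Type*} [DecidableEq ι] (s : Finset ι) (f : ι → Polynomial ℂ) (a : ι → ℂ)
    (hf : ∀ i, Polynomial.derivative (f i) = Polynomial.C (a i)) (z : ℂ) (ω : ℝ) (hω : 0 < ω)
    (m : ι → ℝ) (hm : ∀ i ∈ s, ‖(f i).eval z‖ ≤ m i) (hm' : ∀ i ∈ s, ‖a i‖ ≤ m i * ω) (k : ℕ) :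
    ‖(Polynomial.derivative^[k] (∏ i ∈ s, f i)).eval z‖ ≤
      ((k : ℝ) + 1) ^ s.card * ω ^ k * ∏ i ∈ s, m i := by
  induction s using Finset.induction_on generalizing k with
  | empty =>
    rcases k with _ | k
    · simp
    · simp only [Finset.prod_empty, Function.iterate_succ_apply, Polynomial.derivative_one,
        Polynomial.iterate_derivative_zero, Polynomial.eval_zero, norm_zero]
      positivity
  | insert i s hi ih =>
    have ih := ih (fun i h => hm i (Finset.mem_insert_of_mem h))
      (fun i h => hm' i (Finset.mem_insert_of_mem h))
    have h1 := hm i (Finset.mem_insert_self _ _)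
    have h2 := hm' i (Finset.mem_insert_self _ _)
    have hmi : 0 ≤ m i := (norm_nonneg _).trans h1
    have hP : 0 ≤ ∏ i ∈ s, m i := Finset.prod_nonneg fun i h =>
      (norm_nonneg _).trans (hm i (Finset.mem_insert_of_mem h))
    rw [Finset.prod_insert hi, Finset.prod_insert hi, Finset.card_insert_of_notMem hi,
      aux_iter_deriv_mul _ _ _ (hf i)]
    simp only [Polynomial.eval_add, Polynomial.eval_mul, Polynomial.eval_natCast,
      Polynomial.eval_C]
    refine (norm_add_le _ _).trans ?_
    rw [norm_mul, norm_mul, norm_mul, Complex.norm_natCast]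
    set P := ∏ i ∈ s, m i
    have e1 : ‖(f i).eval z‖ * ‖(Polynomial.derivative^[k] (∏ i ∈ s, f i)).eval z‖ ≤
        m i * (((k : ℝ) + 1) ^ s.card * ω ^ k * P) :=
      mul_le_mul h1 (ih k) (norm_nonneg _) hmi
    have e2 : (k : ℝ) * ‖a i‖ * ‖(Polynomial.derivative^[k-1] (∏ i ∈ s, f i)).eval z‖ ≤
        k * m i * (((k : ℝ) + 1) ^ s.card * ω ^ k * P) := by
      rcases k with _ | k
      · simp
      · have : (k + 1 : ℝ) ^ s.card ≤ (k + 1 + 1 : ℝ) ^ s.card := by gcongr; linarith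
        calc _ ≤ ((k + 1 : ℕ) : ℝ) * (m i * ω) * (((k : ℝ) + 1) ^ s.card * ω ^ k * P) := by
              gcongr
              exact ih k
          _ ≤ ((k + 1 : ℕ) : ℝ) * (m i * ω) * (((k : ℝ) + 1 + 1) ^ s.card * ω ^ k * P) := by
              gcongr
          _ = _ := by push_cast; ring
    calc _ ≤ _ := add_le_add e1 e2
      _ = _ := by ring

/-- Repeated integration by parts. -/
lemma aux_ibp (ω : ℝ) (hω : 0 < ω) (N : ℕ) (p : Polynomial ℂ)
    (hp : Polynomial.derivative^[N] p = 0) :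
    ‖∫ t in (-1 : ℝ)..1, p.eval (t : ℂ) * Complex.exp (Complex.I * ω * t)‖ ≤
      ∑ k ∈ Finset.range N, (‖(Polynomial.derivative^[k] p).eval 1‖ +
        ‖(Polynomial.derivative^[k] p).eval (-1)‖) / ω ^ (k + 1) := by
  induction N generalizing p with
  | zero =>
    simp only [Function.iterate_zero, id] at hp
    simp [hp]
  | succ N ih =>
    have ih := ih (Polynomial.derivative p) (by rwa [← Function.iterate_succ_apply])
    have hne : Complex.I * ω ≠ 0 := by
      simp [hω.ne']
    have hnorm : ∀ t : ℝ, ‖Complex.exp (Complex.I * ω * t)‖ = 1 := by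
      intro t
      rw [show Complex.I * ω * t = ((ω * t : ℝ) : ℂ) * Complex.I by push_cast; ring]
      exact Complex.norm_exp_ofReal_mul_I _
    have hu : ∀ t : ℝ, HasDerivAt (fun t : ℝ => p.eval (t : ℂ))
        ((Polynomial.derivative p).eval (t : ℂ)) t := fun t =>
      (p.hasDerivAt (t : ℂ)).comp_ofReal
    have hv : ∀ t : ℝ, HasDerivAt
        (fun t : ℝ => Complex.exp (Complex.I * ω * t) / (Complex.I * ω))
        (Complex.exp (Complex.I * ω * t)) t := by
      intro t
      have h0 : HasDerivAt (fun y : ℂ => Complex.exp (Complex.I * ω * y) / (Complex.I * ω))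
          (Complex.exp (Complex.I * ω * (t : ℂ))) (t : ℂ) := by
        have h := ((((hasDerivAt_id (t : ℂ)).const_mul (Complex.I * ω)).cexp).div_const
          (Complex.I * ω))
        rw [mul_one, mul_div_assoc, div_self hne, mul_one] at h
        exact h
      exact h0.comp_ofReal
    have hibp := intervalIntegral.integral_mul_deriv_eq_deriv_mul (a := (-1 : ℝ)) (b := 1)
      (fun t _ => hu t) (fun t _ => hv t)
      (Continuous.intervalIntegrable (by fun_prop) _ _)
      (Continuous.intervalIntegrable (by fun_prop) _ _)
    rw [hibp]
    simp only [← mul_div_assoc]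
    rw [intervalIntegral.integral_div]
    refine (norm_sub_le _ _).trans ?_
    have hI : ‖Complex.I * (ω : ℂ)‖ = ω := by simp [abs_of_pos hω]
    have b1 := norm_sub_le
      (Polynomial.eval ((1 : ℝ) : ℂ) p * Complex.exp (Complex.I * ω * (1 : ℝ)) / (Complex.I * ω))
      (Polynomial.eval ((-1 : ℝ) : ℂ) p * Complex.exp (Complex.I * ω * (-1 : ℝ)) / (Complex.I * ω))
    rw [norm_div, norm_div, hI, norm_mul, norm_mul (Polynomial.eval ((-1 : ℝ) : ℂ) p), hnorm, hnorm] at b1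
    rw [norm_div _ (Complex.I * (ω : ℂ)), hI, Finset.sum_range_succ']
    have b2 := div_le_div_of_nonneg_right ih hω.le
    rw [Finset.sum_div] at b2
    rw [add_comm]
    refine add_le_add (b2.trans (le_of_eq ?_)) (b1.trans (le_of_eq ?_))
    · refine Finset.sum_congr rfl fun k _ => ?_
      rw [Function.iterate_succ_apply, div_div, ← pow_succ]
    · simp
      ring

/-- The cluster center. -/
noncomputable def auxE (b : Bool) : ℂ := if b then -1 else 1

lemma aux_ne (b b' : Bool) (h : b ≠ b') : ‖auxE b - auxE b'‖ = 2 := by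
  cases b <;> cases b' <;> simp_all [auxE] <;> norm_num

lemma aux_prod_one (n : ℕ) (ω : ℝ) (hω : 0 < ω) (β : Bool) :
    ∏ i : Fin (2 * n), (if decide ((i : ℕ) < n) = β then ω else ω⁻¹) = 1 := by
  rw [Fin.prod_univ_eq_prod_range (fun i => if decide (i < n) = β then ω else ω⁻¹) (2 * n),
    two_mul, Finset.prod_range_add]
  have h1 : ∏ i ∈ Finset.range n, (if decide (i < n) = β then ω else ω⁻¹) =
      ∏ i ∈ Finset.range n, (if true = β then ω else ω⁻¹) :=
    Finset.prod_congr rfl fun i hi => by rw [decide_eq_true (Finset.mem_range.1 hi)]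
  have h2 : ∏ i ∈ Finset.range n, (if decide (n + i < n) = β then ω else ω⁻¹) =
      ∏ i ∈ Finset.range n, (if false = β then ω else ω⁻¹) :=
    Finset.prod_congr rfl fun i hi => by rw [decide_eq_false (by omega)]
  rw [h1, h2, ← Finset.prod_mul_distrib]
  apply Finset.prod_eq_one
  intro i _
  cases β <;> simp [hω.ne']

/-- Bound for the derivatives of the Lagrange basis polynomial at an endpoint. -/
lemma aux_main (n : ℕ) (Ω : ℝ) (hΩ : 0 < Ω) (B c : ℝ) (hB : 0 ≤ B) (hc : 0 < c)
    (ω : ℝ) (hω : Ω ≤ ω) (y : Fin (2 * n) → ℂ)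
    (hy : ∀ i : Fin (2 * n), ‖y i - auxE (decide ((i : ℕ) < n))‖ ≤ B / ω)
    (hs : ∀ i j, i ≠ j → c / ω ≤ ‖y i - y j‖) (j : Fin (2 * n)) (β : Bool) (k : ℕ) :
    ‖(Polynomial.derivative^[k] (∏ i ∈ Finset.univ.erase j,
      (Polynomial.C ((y j - y i)⁻¹) * (Polynomial.X - Polynomial.C (y i))))).eval (auxE β)‖ ≤
    ((k : ℝ) + 1) ^ (2 * n - 1) * ω ^ k *
      (((1 / c + 1 + B / c) * (B + 2 + B / Ω + 1 + 1 / Ω)) ^ (2 * n - 1) * (1 + 1 / Ω)) := by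
  have hω0 : 0 < ω := hΩ.trans_le hω
  set b : Fin (2 * n) → Bool := fun i => decide ((i : ℕ) < n) with hb
  set L := 1 / c + 1 + B / c with hL
  set M := B + 2 + B / Ω with hM
  have hL0 : 0 < L := by positivity
  have hM0 : 0 < M := by positivity
  have hcard : (Finset.univ.erase j).card = 2 * n - 1 := by simp
  set K := L * (M + 1 + 1 / Ω) with hK
  have hK0 : 0 < K := by positivity
  have hBω : B / ω ≤ B / Ω := by gcongr
  -- inverse distances
  have hD1 : ∀ i, i ≠ j → ‖(y j - y i)⁻¹‖ ≤ L * ω := by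
    intro i hij
    have h := hs j i hij.symm
    rw [norm_inv]
    calc _ ≤ (c / ω)⁻¹ := by gcongr
      _ = (1 / c) * ω := by field_simp
      _ ≤ _ := by
        gcongr
        have : 0 ≤ B / c := by positivity
        linarith
  have hD2 : ∀ i, i ≠ j → b i ≠ b j → ‖(y j - y i)⁻¹‖ ≤ L := by
    intro i hij hbij
    have h := hs j i hij.symm
    have hpos : 0 < ‖y j - y i‖ := lt_of_lt_of_le (by positivity) h
    have h2 : 2 ≤ ‖y j - y i‖ + 2 * (B / ω) := by
      have e : auxE (b j) - auxE (b i) = (y j - y i) - (y j - auxE (b j)) +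
        (y i - auxE (b i)) := by ring
      have h3 := aux_ne (b j) (b i) hbij.symm
      rw [e] at h3
      have h4 := norm_add_le ((y j - y i) - (y j - auxE (b j))) (y i - auxE (b i))
      have h5 := norm_sub_le (y j - y i) (y j - auxE (b j))
      have h6 := hy i
      have h7 := hy j
      simp only [hb] at *
      linarith
    have h3 : B / ω ≤ B / c * ‖y j - y i‖ := by
      calc B / ω = B / c * (c / ω) := by field_simp
        _ ≤ _ := by gcongr
    rw [norm_inv, inv_le_iff_one_le_mul₀ hpos]
    have : 0 ≤ 1 / c * ‖y j - y i‖ := by positivity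
    rw [hL]
    nlinarith
  -- values
  have hV1 : ∀ i, ‖auxE β - y i‖ ≤ M := by
    intro i
    have h1 : ‖auxE β - auxE (b i)‖ ≤ 2 := by
      by_cases h : β = b i
      · rw [h]; simp
      · exact (aux_ne _ _ h).le
    have h2 := norm_sub_le (auxE β - auxE (b i)) (y i - auxE (b i))
    rw [sub_sub_sub_cancel_right] at h2
    have h3 := hy i
    simp only [hb] at *
    linarith
  have hV2 : ∀ i, b i = β → ‖auxE β - y i‖ ≤ M * ω⁻¹ := by
    intro i h
    have h3 := hy i
    rw [norm_sub_rev, ← h]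
    refine h3.trans ?_
    rw [div_eq_mul_inv]
    gcongr
    have : 0 ≤ B / Ω := by positivity
    linarith
  have hΩω : 1 ≤ 1 / Ω * ω := by
    rw [one_div, inv_mul_eq_div, one_le_div hΩ]; exact hω
  have hLM : L * M ≤ K := by
    rw [hK]; gcongr; have : 0 < 1 / Ω := by positivity
    linarith
  have hLK : L ≤ K := by
    rw [hK]; have : 0 < 1 / Ω := by positivity
    nlinarith
  have hLKω : L ≤ K * ω := by
    have : L * (1 / Ω) ≤ K := by rw [hK]; gcongr; linarith
    nlinarith [mul_le_mul_of_nonneg_right this hω0.le]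
  have hder : ∀ i, Polynomial.derivative
      (Polynomial.C ((y j - y i)⁻¹) * (Polynomial.X - Polynomial.C (y i))) =
      Polynomial.C ((y j - y i)⁻¹) := by intro i; simp
  set g : Fin (2 * n) → ℝ := fun i => if β = b j then 1 else if b i = b j then ω else ω⁻¹ with hg
  have hprod : ∏ i ∈ Finset.univ.erase j, g i ≤ 1 + 1 / Ω := by
    by_cases hβ : β = b j
    · simp only [hg, hβ, if_true, Finset.prod_const_one]
      have : 0 < 1 / Ω := by positivity
      linarith
    · simp only [hg, hβ, if_false]
      have h1 := aux_prod_one n ω hω0 (b j)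
      rw [← Finset.mul_prod_erase _ _ (Finset.mem_univ j)] at h1
      simp only [hb, if_true] at h1 ⊢
      rw [eq_inv_of_mul_eq_one_right h1]
      have : ω⁻¹ ≤ Ω⁻¹ := by gcongr
      rw [one_div]; linarith
  have key := aux_prod_bound (Finset.univ.erase j)
    (fun i => Polynomial.C ((y j - y i)⁻¹) * (Polynomial.X - Polynomial.C (y i)))
    (fun i => (y j - y i)⁻¹) hder (auxE β) ω hω0 (fun i => K * g i) ?_ ?_ k
  · refine key.trans ?_
    rw [Finset.prod_mul_distrib, Finset.prod_const, hcard]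
    gcongr
  · intro i hi
    have hij := Finset.ne_of_mem_erase hi
    simp only [Polynomial.eval_mul, Polynomial.eval_C, Polynomial.eval_sub, Polynomial.eval_X,
      norm_mul]
    by_cases hβ : β = b j <;> by_cases hbi : b i = b j
    · have := mul_le_mul (hD1 i hij) (hV2 i (hbi.trans hβ.symm)) (norm_nonneg _) (by positivity)
      simp only [hg, if_pos hβ, mul_one]
      refine this.trans (le_trans (le_of_eq ?_) hLM)
      field_simp
    · have := mul_le_mul (hD2 i hij hbi) (hV1 i) (norm_nonneg _) (by positivity)
      simp only [hg, if_pos hβ, mul_one]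
      exact this.trans hLM
    · have := mul_le_mul (hD1 i hij) (hV1 i) (norm_nonneg _) (by positivity)
      simp only [hg, if_neg hβ, if_pos hbi]
      refine this.trans ?_
      rw [mul_right_comm]
      gcongr
    · have hiβ : b i = β := by
        revert hβ hbi
        cases b i <;> cases b j <;> cases β <;> simp
      have := mul_le_mul (hD2 i hij hbi) (hV2 i hiβ) (norm_nonneg _) (by positivity)
      simp only [hg, if_neg hβ, if_neg hbi]
      refine this.trans ?_
      rw [← mul_assoc]
      gcongr
  · intro i hi
    have hij := Finset.ne_of_mem_erase hi
    by_cases hβ : β = b j <;> by_cases hbi : b i = b j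
    · simp only [hg, if_pos hβ, mul_one]
      exact (hD1 i hij).trans (by gcongr)
    · simp only [hg, if_pos hβ, mul_one]
      exact (hD2 i hij hbi).trans hLKω
    · simp only [hg, if_neg hβ, if_pos hbi]
      exact (hD1 i hij).trans (by gcongr)
    · simp only [hg, if_neg hβ, if_neg hbi]
      refine (hD2 i hij hbi).trans ?_
      rw [mul_assoc, inv_mul_cancel₀ hω0.ne', mul_one]
      exact hLK

theorem interpolatory_weights_are_O_omega_inv
    (n : ℕ) (hn : 1 ≤ n) (Ω : ℝ) (hΩ : 0 < Ω)
    (x : ℝ → Fin (2 * n) → ℂ)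
    (hdistinct : ∀ ω ≥ Ω, Function.Injective (x ω))
    (hcluster : ∃ B : ℝ, ∀ ω ≥ Ω, ∀ j : Fin (2 * n),
      ((j : ℕ) < n → ω * ‖x ω j + 1‖ ≤ B) ∧ (n ≤ (j : ℕ) → ω * ‖x ω j - 1‖ ≤ B))
    (hsep : ∃ c : ℝ, 0 < c ∧ ∀ ω ≥ Ω, ∀ i j : Fin (2 * n), i ≠ j →
      c / ω ≤ ‖x ω i - x ω j‖) :
    ∃ C : ℝ, ∀ ω ≥ Ω, ∀ j : Fin (2 * n),
      ‖∫ t in (-1 : ℝ)..1,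
          (∏ i ∈ Finset.univ.erase j, (((t : ℂ) - x ω i) / (x ω j - x ω i))) *
            Complex.exp (Complex.I * ω * t)‖ ≤ C / ω := by
  obtain ⟨B, hB⟩ := hcluster
  obtain ⟨c, hc, hs⟩ := hsep
  have hB0 : 0 ≤ B := by
    have h := (hB Ω le_rfl ⟨0, by omega⟩).1 hn
    exact le_trans (by positivity) h
  set A := ((1 / c + 1 + B / c) * (B + 2 + B / Ω + 1 + 1 / Ω)) ^ (2 * n - 1) * (1 + 1 / Ω) with hA
  refine ⟨∑ k ∈ Finset.range (2 * n), 2 * (((k : ℝ) + 1) ^ (2 * n - 1) * A), ?_⟩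
  intro ω hω j
  have hω0 : 0 < ω := hΩ.trans_le hω
  have hy : ∀ i : Fin (2 * n), ‖x ω i - auxE (decide ((i : ℕ) < n))‖ ≤ B / ω := by
    intro i
    rw [le_div_iff₀' hω0]
    by_cases h : (i : ℕ) < n
    · have := (hB ω hω i).1 h
      simpa [auxE, h] using this
    · have := (hB ω hω i).2 (by omega)
      simpa [auxE, h] using this
  set p : Polynomial ℂ := ∏ i ∈ Finset.univ.erase j,
      (Polynomial.C ((x ω j - x ω i)⁻¹) * (Polynomial.X - Polynomial.C (x ω i))) with hp
  have hmain := fun β k => aux_main n Ω hΩ B c hB0 hc ω hω (x ω) hy (hs ω hω) j β k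
  have hdeg : p.natDegree < 2 * n := by
    have h1 : p.natDegree ≤ ∑ i ∈ Finset.univ.erase j, 1 := by
      refine (Polynomial.natDegree_prod_le _ _).trans (Finset.sum_le_sum fun i _ => ?_)
      refine (Polynomial.natDegree_C_mul_le _ _).trans ?_
      exact (Polynomial.natDegree_X_sub_C _).le
    simp at h1
    omega
  have hibp := aux_ibp ω hω0 (2 * n) p (Polynomial.iterate_derivative_eq_zero hdeg)
  have hint : ∀ t : ℝ, (∏ i ∈ Finset.univ.erase j, (((t : ℂ) - x ω i) / (x ω j - x ω i))) =
      p.eval (t : ℂ) := by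
    intro t
    rw [hp, Polynomial.eval_prod]
    refine Finset.prod_congr rfl fun i _ => ?_
    simp [div_eq_inv_mul]
  simp only [hint]
  refine hibp.trans ?_
  rw [Finset.sum_div]
  refine Finset.sum_le_sum fun k _ => ?_
  have h1 := hmain false k
  have h2 := hmain true k
  simp only [auxE, if_true, Bool.false_eq_true, if_false] at h1 h2
  rw [div_le_div_iff₀ (by positivity) hω0]
  calc _ ≤ (((k : ℝ) + 1) ^ (2 * n - 1) * ω ^ k * A + ((k : ℝ) + 1) ^ (2 * n - 1) * ω ^ k * A) * ω :=
        mul_le_mul_of_nonneg_right (add_le_add h1 h2) hω0.le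
    _ = _ := by ring
end

section
/- Let n ≥ 1 and let α : Fin n → ℕ be strictly increasing (α_1 < α_2 < … < α_n). In the multivariate polynomial ring ℤ[X_1,…,X_n], the determinant of the n×n generalised Vandermonde matrix G with entries G_{ij} = X_i^{α_j} is divisible by the Vandermonde product ∏_{1 ≤ i < j ≤ n} (X_i − X_j); that is, there exists a polynomial L ∈ ℤ[X_1,…,X_n] with det(G) = L · ∏_{1 ≤ i < j ≤ n} (X_i − X_j). -/
open MvPolynomial

/-- Reducing `T ^ a` modulo `∏ (T - v i)` expresses the generalised Vandermonde matrix
as the ordinary one times a coefficient matrix. -/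
theorem gen_vandermonde_factor {R : Type*} [CommRing R] [Nontrivial R] (n : ℕ)
    (v : Fin n → R) (α : Fin n → ℕ) :
    ∃ C : Matrix (Fin n) (Fin n) R,
      (Matrix.of fun i j : Fin n => v i ^ α j) = Matrix.vandermonde v * C := by
  classical
  set P : Polynomial R := ∏ i, (Polynomial.X - Polynomial.C (v i)) with hP
  have hm : P.Monic := Polynomial.monic_prod_of_monic _ _ fun i _ => Polynomial.monic_X_sub_C _
  have hd : P.natDegree = n := by
    rw [hP, Polynomial.natDegree_prod_of_monic _ _ fun i _ => Polynomial.monic_X_sub_C _]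
    simp
  refine ⟨Matrix.of fun k j => ((Polynomial.X ^ α j : Polynomial R) %ₘ P).coeff k, ?_⟩
  ext i j
  have h0 : P.eval (v i) = 0 := by
    rw [hP, Polynomial.eval_prod]
    exact Finset.prod_eq_zero (Finset.mem_univ i) (by simp)
  have h1 : ((Polynomial.X ^ α j : Polynomial R) %ₘ P).eval (v i) = v i ^ α j := by
    have h := congrArg (Polynomial.eval (v i))
      (Polynomial.modByMonic_add_div (Polynomial.X ^ α j : Polynomial R) P)
    simpa [h0] using h
  have hlt : ((Polynomial.X ^ α j : Polynomial R) %ₘ P).degree < (n : ℕ) := by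
    have h := Polynomial.degree_modByMonic_lt (Polynomial.X ^ α j : Polynomial R) hm
    rwa [Polynomial.degree_eq_natDegree hm.ne_zero, hd] at h
  rw [Matrix.of_apply, ← h1, Matrix.mul_apply]
  by_cases hz : ((Polynomial.X ^ α j : Polynomial R) %ₘ P) = 0
  · simp [hz]
  rw [Polynomial.eval_eq_sum_range' ((Polynomial.natDegree_lt_iff_degree_lt hz).2 hlt),
    Finset.sum_range]
  simp [Matrix.vandermonde_apply, mul_comm]

theorem generalized_vandermonde_divisible_by_vandermonde
    (n : ℕ) (hn : 1 ≤ n) (α : Fin n → ℕ) (hα : StrictMono α) :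
    ∃ L : MvPolynomial (Fin n) ℤ,
      Matrix.det (Matrix.of fun i j : Fin n => (X i : MvPolynomial (Fin n) ℤ) ^ (α j)) =
        L * ∏ p ∈ Finset.univ.filter (fun p : Fin n × Fin n => p.1 < p.2),
          ((X p.1 : MvPolynomial (Fin n) ℤ) - X p.2) := by
  obtain ⟨C, hC⟩ := gen_vandermonde_factor n (fun i => (X i : MvPolynomial (Fin n) ℤ)) α
  have hV : (Matrix.vandermonde fun i => (X i : MvPolynomial (Fin n) ℤ)).det =
      ∏ p ∈ Finset.univ.filter (fun p : Fin n × Fin n => p.1 < p.2),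
        (-1) * ((X p.1 : MvPolynomial (Fin n) ℤ) - X p.2) := by
    rw [Matrix.det_vandermonde, Finset.prod_filter, Fintype.prod_prod_type]
    refine Finset.prod_congr rfl fun i _ => ?_
    rw [← Finset.prod_filter]
    refine Finset.prod_congr (by ext; simp) fun j _ => ?_
    ring
  rw [Finset.prod_mul_distrib] at hV
  rw [hC, Matrix.det_mul, hV]
  exact ⟨_, by rw [mul_right_comm]⟩
end
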